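/- For all natural numbers m and n with m > 0 or n < 2, the rule Ros□ is admissible in NAmn, i.e., NpAmn = NAmn: every modal formula provable in NpAmn is already provable in NAmn (in particular, if NAmn ⊢ ¬□φ then NAmn ⊢ ¬□□φ). -/

import Mathlib

/-- Propositional formulas. -/
inductive PropForm : Type
  | var : ℕ → PropForm
  | fls : PropForm
  | and : PropForm → PropForm → PropForm
  | or : PropForm → PropForm → PropForm
  | imp : PropForm → PropForm → PropForm
  deriving DecidableEq

/-- Boolean evaluation of a propositional formula. -/
def PropForm.eval (v : ℕ → Bool) : PropForm → Bool
  | .var i => v i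
  | .fls => false
  | .and φ ψ => φ.eval v && ψ.eval v
  | .or φ ψ => φ.eval v || ψ.eval v
  | .imp φ ψ => !φ.eval v || ψ.eval v

/-- Classical propositional tautology. -/
def PropForm.Taut (φ : PropForm) : Prop := ∀ v, φ.eval v = true

/-- Modal formulas. -/
inductive ModalForm : Type
  | var : ℕ → ModalForm
  | fls : ModalForm
  | and : ModalForm → ModalForm → ModalForm
  | or : ModalForm → ModalForm → ModalForm
  | imp : ModalForm → ModalForm → ModalForm
  | box : ModalForm → ModalForm
  deriving DecidableEq

/-- Substitution of modal formulas for the variables of a propositional formula. -/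
def PropForm.subst (σ : ℕ → ModalForm) : PropForm → ModalForm
  | .var i => σ i
  | .fls => .fls
  | .and φ ψ => .and (φ.subst σ) (ψ.subst σ)
  | .or φ ψ => .or (φ.subst σ) (ψ.subst σ)
  | .imp φ ψ => .imp (φ.subst σ) (ψ.subst σ)

/-- ¬φ abbreviates φ → ⊥. -/
def ModalForm.neg (φ : ModalForm) : ModalForm := .imp φ .fls

/-- □^k φ : k-fold application of □. -/
def ModalForm.boxIter : ℕ → ModalForm → ModalForm
  | 0, φ => φ
  | k + 1, φ => .box (ModalForm.boxIter k φ)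

/-- ¬^j φ : j-fold application of ¬. -/
def ModalForm.negIter : ℕ → ModalForm → ModalForm
  | 0, φ => φ
  | k + 1, φ => (ModalForm.negIter k φ).neg

/-- φ ↔ ψ abbreviates (φ → ψ) ∧ (ψ → φ). -/
def ModalForm.iff (φ ψ : ModalForm) : ModalForm := .and (.imp φ ψ) (.imp ψ φ)

/-- Signed variables: `Vsgn φ true` is V⁺(φ), `Vsgn φ false` is V⁻(φ). -/
def ModalForm.Vsgn : ModalForm → Bool → Finset ℕ
  | .var i, true => {i}
  | .var _, false => ∅
  | .fls, _ => ∅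
  | .and φ ψ, b => φ.Vsgn b ∪ ψ.Vsgn b
  | .or φ ψ, b => φ.Vsgn b ∪ ψ.Vsgn b
  | .imp φ ψ, b => φ.Vsgn (!b) ∪ ψ.Vsgn b
  | .box φ, b => φ.Vsgn b

/-- Positive variables V⁺(φ). -/
def ModalForm.Vpos (φ : ModalForm) : Finset ℕ := φ.Vsgn true

/-- Negative variables V⁻(φ). -/
def ModalForm.Vneg (φ : ModalForm) : Finset ℕ := φ.Vsgn false

/-- All variables V(φ). -/
def ModalForm.V (φ : ModalForm) : Finset ℕ := φ.Vpos ∪ φ.Vneg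

/-- The logic NAmn = N + (Amn : □ⁿφ → □ᵐφ). -/
inductive NA (m n : ℕ) : ModalForm → Prop
  | taut (p : PropForm) (σ : ℕ → ModalForm) : p.Taut → NA m n (p.subst σ)
  | amn (φ : ModalForm) : NA m n (.imp (ModalForm.boxIter n φ) (ModalForm.boxIter m φ))
  | mp (φ ψ : ModalForm) : NA m n (.imp φ ψ) → NA m n φ → NA m n ψ
  | nec (φ : ModalForm) : NA m n φ → NA m n (.box φ)

/-- The logic NpAmn = NAmn + (Ros□ : from ¬□φ infer ¬□□φ). -/
inductive NpA (m n : ℕ) : ModalForm → Prop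
  | taut (p : PropForm) (σ : ℕ → ModalForm) : p.Taut → NpA m n (p.subst σ)
  | amn (φ : ModalForm) : NpA m n (.imp (ModalForm.boxIter n φ) (ModalForm.boxIter m φ))
  | mp (φ ψ : ModalForm) : NpA m n (.imp φ ψ) → NpA m n φ → NpA m n ψ
  | nec (φ : ModalForm) : NpA m n φ → NpA m n (.box φ)
  | rosbox (φ : ModalForm) : NpA m n (ModalForm.neg (.box φ)) →
      NpA m n (ModalForm.neg (.box (.box φ)))

/-- Boolean evaluation of a modal formula, with every variable false and every boxed formula true. -/
def ModalForm.evalBoxTrue : ModalForm → Bool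
  | .var _ => false
  | .fls => false
  | .and φ ψ => φ.evalBoxTrue && ψ.evalBoxTrue
  | .or φ ψ => φ.evalBoxTrue || ψ.evalBoxTrue
  | .imp φ ψ => !φ.evalBoxTrue || ψ.evalBoxTrue
  | .box _ => true

theorem PropForm.evalBoxTrue_subst (σ : ℕ → ModalForm) (p : PropForm) :
    (p.subst σ).evalBoxTrue = p.eval fun i => (σ i).evalBoxTrue := by
  induction p <;> simp_all [PropForm.subst, PropForm.eval, ModalForm.evalBoxTrue]

theorem NA.evalBoxTrue {m n : ℕ} (hmn : m > 0 ∨ n = 0) {φ : ModalForm} (h : NA m n φ) :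
    φ.evalBoxTrue = true := by
  induction h with
  | taut p σ hp => rw [PropForm.evalBoxTrue_subst]; exact hp _
  | amn φ =>
    cases m with
    | zero =>
      obtain rfl : n = 0 := by omega
      simp [ModalForm.boxIter, ModalForm.evalBoxTrue]
    | succ k => simp [ModalForm.boxIter, ModalForm.evalBoxTrue]
  | mp φ ψ _ _ ih₁ ih₂ => simpa [ModalForm.evalBoxTrue, ih₂] using ih₁
  | nec φ _ _ => rfl

theorem NA.not_neg_box {m n : ℕ} (hmn : m > 0 ∨ n = 0) (φ : ModalForm) :
    ¬ NA m n (ModalForm.neg (.box φ)) := fun h => by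
  simpa [ModalForm.neg, ModalForm.evalBoxTrue] using h.evalBoxTrue hmn

/-- Modus tollens. -/
theorem NA.neg_of_imp {m n : ℕ} {φ ψ : ModalForm} (h : NA m n (.imp φ ψ)) (hψ : NA m n ψ.neg) :
    NA m n φ.neg := by
  have contraposition : NA m n (.imp (.imp φ ψ) (.imp ψ.neg φ.neg)) :=
    NA.taut (.imp (.imp (.var 0) (.var 1)) (.imp (.imp (.var 1) .fls) (.imp (.var 0) .fls)))
      (fun i => if i = 0 then φ else ψ)
      (fun v => by simp only [PropForm.eval]; cases v 0 <;> cases v 1 <;> rfl)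
  exact .mp _ _ (.mp _ _ contraposition h) hψ

theorem NA.rosbox {m n : ℕ} (hmn : m > 0 ∨ n < 2) {φ : ModalForm}
    (h : NA m n (ModalForm.neg (.box φ))) : NA m n (ModalForm.neg (.box (.box φ))) := by
  by_cases hbox : m > 0 ∨ n = 0
  · exact absurd h (NA.not_neg_box hbox φ)
  · obtain ⟨rfl, rfl⟩ : m = 0 ∧ n = 1 := by omega
    exact (NA.amn (.box φ)).neg_of_imp h

/-- If m > 0 or n < 2, then Ros□ is admissible in NAmn, i.e. NpAmn = NAmn. -/
theorem NpA_eq_NA_of (m n : ℕ) (hmn : m > 0 ∨ n < 2) :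
    ∀ φ : ModalForm, NpA m n φ ↔ NA m n φ := by
  intro φ
  constructor <;> intro h
  · induction h with
    | taut p σ hp => exact .taut p σ hp
    | amn φ => exact .amn φ
    | mp φ ψ _ _ ih₁ ih₂ => exact .mp φ ψ ih₁ ih₂
    | nec φ _ ih => exact .nec φ ih
    | rosbox φ _ ih => exact ih.rosbox hmn
  · induction h with
    | taut p σ hp => exact .taut p σ hp
    | amn φ => exact .amn φ
    | mp φ ψ _ _ ih₁ ih₂ => exact .mp φ ψ ih₁ ih₂
    | nec φ _ ih => exact .nec φ ih
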